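/- (Hilbert) Let n ≥ 3 and let i_1, …, i_{n−2} be homogeneous polynomial invariants of V_n of positive degree. Then the following are equivalent: (i) the common vanishing locus of i_1, …, i_{n−2} in V_n equals the nullcone N(V_n); (ii) {i_1, …, i_{n−2}} is a homogeneous system of parameters of O(V_n)^{SL_2}. -/

import Mathlib

open MvPolynomial

/-- The `k`-th transvectant of two binary forms `f` of degree `n` and `g` of degree `m`
(coefficients in a commutative `ℂ`-algebra `R`). -/
noncomputable def transv {R : Type} [CommRing R] [Algebra ℂ R] (n m k : ℕ)
    (f g : MvPolynomial (Fin 2) R) : MvPolynomial (Fin 2) R :=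
  ((((n - k).factorial * (m - k).factorial : ℕ) : ℂ) / ((n.factorial * m.factorial : ℕ) : ℂ)) •
    ∑ i ∈ Finset.range (k + 1),
      ((-1 : ℂ) ^ i * (k.choose i : ℂ)) •
        ((fun p => pderiv (0 : Fin 2) p)^[k - i] ((fun p => pderiv (1 : Fin 2) p)^[i] f) *
         (fun p => pderiv (0 : Fin 2) p)^[i] ((fun p => pderiv (1 : Fin 2) p)^[k - i] g))

/-- The binary form of degree `n` with coefficient vector `a`,
`f = ∑ binom(n,i) aᵢ x^(n-i) y^i`. -/
noncomputable def formOf (n : ℕ) (a : Fin (n + 1) → ℂ) : MvPolynomial (Fin 2) ℂ :=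
  ∑ i : Fin (n + 1), C ((n.choose (i : ℕ) : ℂ) * a i) * X 0 ^ (n - (i : ℕ)) * X 1 ^ (i : ℕ)

/-- The action of `SL₂(ℂ)` on binary forms: `(g · f)(v) = f (g⁻¹ v)`. -/
noncomputable def sl2Act (g : Matrix.SpecialLinearGroup (Fin 2) ℂ)
    (f : MvPolynomial (Fin 2) ℂ) : MvPolynomial (Fin 2) ℂ :=
  aeval (fun i => ∑ j,
    (((g⁻¹ : Matrix.SpecialLinearGroup (Fin 2) ℂ) : Matrix (Fin 2) (Fin 2) ℂ) i j) • X j) f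

/-- The coefficient vector of a binary form of degree `n`:
`aᵢ` is the coefficient of `x^(n-i) y^i` divided by `binom(n,i)`. -/
noncomputable def coeffOf (n : ℕ) (f : MvPolynomial (Fin 2) ℂ) (i : Fin (n + 1)) : ℂ :=
  coeff (Finsupp.single 0 (n - (i : ℕ)) + Finsupp.single 1 (i : ℕ)) f / (n.choose (i : ℕ) : ℂ)

/-- The graded algebra `O(V_n)^{SL₂}` of polynomial invariants of the binary form of
degree `n`: polynomials `P` in the coefficients `a₀, …, aₙ` such that `P` takes the same
value at the coefficients of `g · f` as at the coefficients of `f`, for every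
`g ∈ SL₂(ℂ)` and every `f ∈ Vₙ`. -/
noncomputable def invariantAlgebra (n : ℕ) : Subalgebra ℂ (MvPolynomial (Fin (n + 1)) ℂ) :=
  ⨅ p : Matrix.SpecialLinearGroup (Fin 2) ℂ × (Fin (n + 1) → ℂ),
    AlgHom.equalizer
      (aeval (coeffOf n (sl2Act p.1 (formOf n p.2))) : MvPolynomial (Fin (n + 1)) ℂ →ₐ[ℂ] ℂ)
      (aeval p.2)

/-- `v` is a homogeneous system of parameters of `O(V_n)^{SL₂}`: a family of homogeneous
invariants, algebraically independent over `ℂ`, such that `O(V_n)^{SL₂}` is a finitely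
generated module over the `ℂ`-subalgebra they generate. -/
def IsHSOP (n : ℕ) {ι : Type} [Fintype ι] (v : ι → MvPolynomial (Fin (n + 1)) ℂ) : Prop :=
  (∀ i, v i ∈ invariantAlgebra n) ∧
  (∀ i, ∃ d : ℕ, (v i).IsHomogeneous d) ∧
  AlgebraicIndependent ℂ v ∧
  ∃ F : Finset (MvPolynomial (Fin (n + 1)) ℂ),
    (F : Set (MvPolynomial (Fin (n + 1)) ℂ)) ⊆
      (invariantAlgebra n : Set (MvPolynomial (Fin (n + 1)) ℂ)) ∧
    ∀ x ∈ invariantAlgebra n,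
      x ∈ Submodule.span (Algebra.adjoin ℂ (Set.range v))
        (F : Set (MvPolynomial (Fin (n + 1)) ℂ))

/-- The generic binary form of degree `n`, with coefficients the variables
`a₀, …, aₙ` of the polynomial ring `ℂ[a₀, …, aₙ]`. -/
noncomputable def genForm (n : ℕ) : MvPolynomial (Fin 2) (MvPolynomial (Fin (n + 1)) ℂ) :=
  ∑ i : Fin (n + 1),
    MvPolynomial.C (MvPolynomial.C (n.choose (i : ℕ) : ℂ) * MvPolynomial.X i) *
      MvPolynomial.X (0 : Fin 2) ^ (n - (i : ℕ)) * MvPolynomial.X (1 : Fin 2) ^ (i : ℕ)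

/-- The nullcone `N(Vₙ)`, described by coefficient vectors: the set of forms on which
every homogeneous polynomial invariant of positive degree vanishes. -/
def nullcone (n : ℕ) : Set (Fin (n + 1) → ℂ) :=
  {a | ∀ P ∈ invariantAlgebra n, ∀ d : ℕ, 0 < d → P.IsHomogeneous d → eval a P = 0}

/-- The coefficient vector of `f ∘ M`, where `f` is the binary form of degree `n` with coefficient
vector `a` and `M` is a `2 × 2` matrix. -/
noncomputable def matAct (n : ℕ) (M : Matrix (Fin 2) (Fin 2) ℂ) (a : Fin (n + 1) → ℂ) :
    Fin (n + 1) → ℂ :=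
  coeffOf n (aeval (fun i => ∑ j, M i j • (X j : MvPolynomial (Fin 2) ℂ)) (formOf n a))

theorem formOf_eq_sum_monomial (n : ℕ) (a : Fin (n + 1) → ℂ) :
    formOf n a = ∑ i : Fin (n + 1),
      monomial (Finsupp.single 0 (n - (i : ℕ)) + Finsupp.single 1 (i : ℕ))
        ((n.choose (i : ℕ) : ℂ) * a i) := by
  refine Finset.sum_congr rfl fun i _ => ?_
  rw [mul_assoc, X_pow_eq_monomial, X_pow_eq_monomial, monomial_mul, C_mul_monomial]
  simp

theorem formOf_isHomogeneous (n : ℕ) (a : Fin (n + 1) → ℂ) : (formOf n a).IsHomogeneous n := by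
  rw [formOf_eq_sum_monomial]
  refine IsHomogeneous.sum _ _ _ fun i _ => isHomogeneous_monomial _ ?_
  simp [Finsupp.degree_eq_sum]
  omega

theorem choose_fin_ne_zero (n : ℕ) (i : Fin (n + 1)) : (n.choose (i : ℕ) : ℂ) ≠ 0 :=
  Nat.cast_ne_zero.2 (Nat.choose_pos (by omega)).ne'

theorem formOf_coeffOf {n : ℕ} {f : MvPolynomial (Fin 2) ℂ} (hf : f.IsHomogeneous n) :
    formOf n (coeffOf n f) = f := by
  ext m
  rw [formOf_eq_sum_monomial, coeff_sum]
  by_cases hm : m.degree = n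
  · have h1 : m 0 + m 1 = n := by simpa [Finsupp.degree_eq_sum] using hm
    have h2 : m = Finsupp.single 0 (n - m 1) + Finsupp.single 1 (m 1) := by
      ext j; fin_cases j <;> (simp; try omega)
    rw [Finset.sum_eq_single ⟨m 1, by omega⟩]
    · rw [coeff_monomial, if_pos h2.symm, coeffOf, mul_div_cancel₀ _ (choose_fin_ne_zero _ _),
        ← h2]
    · intro i _ hi
      rw [coeff_monomial, if_neg]
      intro h
      apply hi
      ext
      simp [← h]
    · simp
  · rw [hf.coeff_eq_zero hm]
    refine Finset.sum_eq_zero fun i _ => ?_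
    rw [coeff_monomial, if_neg]
    rintro rfl
    apply hm
    simp [Finsupp.degree_eq_sum]
    omega

theorem coeffOf_formOf (n : ℕ) (a : Fin (n + 1) → ℂ) : coeffOf n (formOf n a) = a := by
  ext i
  rw [coeffOf, formOf_eq_sum_monomial, coeff_sum, Finset.sum_eq_single i]
  · rw [coeff_monomial, if_pos rfl, mul_div_cancel_left₀ _ (choose_fin_ne_zero _ _)]
  · intro j _ hj
    rw [coeff_monomial, if_neg]
    intro h
    apply hj
    ext
    simpa using DFunLike.congr_fun h 1
  · simp

theorem formOf_matAct (n : ℕ) (M : Matrix (Fin 2) (Fin 2) ℂ) (a : Fin (n + 1) → ℂ) :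
    formOf n (matAct n M a) = aeval (fun i => ∑ j, M i j • X j) (formOf n a) := by
  refine formOf_coeffOf ?_
  have := (formOf_isHomogeneous n a).aeval (fun i => ∑ j, M i j • (X j : MvPolynomial (Fin 2) ℂ))
    (n := 1) fun i => IsHomogeneous.sum _ _ _ fun j _ => by
      rw [smul_eq_C_mul]; exact isHomogeneous_C_mul_X _ _
  simpa using this

theorem matAct_matAct (n : ℕ) (M N : Matrix (Fin 2) (Fin 2) ℂ) (a : Fin (n + 1) → ℂ) :
    matAct n N (matAct n M a) = matAct n (M * N) a := by
  rw [matAct, formOf_matAct, matAct]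
  congr 1
  rw [← AlgHom.comp_apply]
  congr 1
  ext1 i
  simp only [AlgHom.comp_apply, aeval_X, map_sum, map_smul, Matrix.mul_apply, Finset.smul_sum,
    Finset.sum_smul, smul_smul]
  exact Finset.sum_comm

theorem formOf_smul (n : ℕ) (t : ℂ) (a : Fin (n + 1) → ℂ) :
    formOf n (t • a) = t • formOf n a := by
  simp only [formOf_eq_sum_monomial, Finset.smul_sum, smul_monomial]
  refine Finset.sum_congr rfl fun i _ => ?_
  congr 1
  simp only [Pi.smul_apply, smul_eq_mul]
  ring

theorem coeffOf_smul (n : ℕ) (t : ℂ) (f : MvPolynomial (Fin 2) ℂ) :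
    coeffOf n (t • f) = t • coeffOf n f := by
  ext i
  simp [coeffOf, mul_div_assoc]

theorem matAct_vec_smul (n : ℕ) (M : Matrix (Fin 2) (Fin 2) ℂ) (t : ℂ) (a : Fin (n + 1) → ℂ) :
    matAct n M (t • a) = t • matAct n M a := by
  rw [matAct, formOf_smul, map_smul, coeffOf_smul, matAct]

theorem matAct_scalar (n : ℕ) (t : ℂ) (a : Fin (n + 1) → ℂ) :
    matAct n (t • 1) a = t ^ n • a := by
  have : aeval (fun i => ∑ j, (t • (1 : Matrix (Fin 2) (Fin 2) ℂ)) i j •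
      (X j : MvPolynomial (Fin 2) ℂ)) (formOf n a) = t ^ n • formOf n a := by
    simp only [formOf, map_sum, map_mul, map_pow, aeval_X, Finset.smul_sum]
    refine Finset.sum_congr rfl fun i _ => ?_
    have ht : t ^ n = t ^ (n - (i : ℕ)) * t ^ (i : ℕ) := by
      rw [← pow_add]; congr 1; omega
    have hX : ∀ k : Fin 2, ∑ j, (t • (1 : Matrix (Fin 2) (Fin 2) ℂ)) k j •
        (X j : MvPolynomial (Fin 2) ℂ) = C t * X k := by
      intro k; fin_cases k <;> simp [smul_eq_C_mul]
    rw [hX, hX, ht, smul_eq_C_mul]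
    simp only [map_mul, map_pow, mul_pow, algHom_C, algebraMap_eq]
    ring
  rw [matAct, this, coeffOf_smul, coeffOf_formOf]

theorem matAct_one (n : ℕ) (a : Fin (n + 1) → ℂ) : matAct n 1 a = a := by
  simpa using matAct_scalar n 1 a

theorem matAct_mat_smul (n : ℕ) (t : ℂ) (M : Matrix (Fin 2) (Fin 2) ℂ) (a : Fin (n + 1) → ℂ) :
    matAct n (t • M) a = t ^ n • matAct n M a := by
  rw [← matAct_scalar n t (matAct n M a), matAct_matAct]
  simp

theorem mem_invariantAlgebra_iff {n : ℕ} {P : MvPolynomial (Fin (n + 1)) ℂ} :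
    P ∈ invariantAlgebra n ↔ ∀ (g : Matrix.SpecialLinearGroup (Fin 2) ℂ) (a : Fin (n + 1) → ℂ),
      eval (matAct n g.1 a) P = eval a P := by
  simp only [invariantAlgebra, Algebra.mem_iInf, AlgHom.mem_equalizer, Prod.forall, aeval_eq_eval]
  constructor
  · intro h g a
    have := h g⁻¹ a
    rw [sl2Act, inv_inv] at this
    exact this
  · intro h g a
    exact h g⁻¹ a

/-- Evaluation of polynomials in the entries of a `2 × 2` matrix and in the coefficients of a
binary form. -/
noncomputable def evalPair (n : ℕ) (M : Matrix (Fin 2) (Fin 2) ℂ) (a : Fin (n + 1) → ℂ) :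
    MvPolynomial (Fin 2 × Fin 2) (MvPolynomial (Fin (n + 1)) ℂ) →+* ℂ :=
  (eval fun p => M p.1 p.2).comp (map (eval a))

theorem evalPair_C (n : ℕ) (M : Matrix (Fin 2) (Fin 2) ℂ) (a : Fin (n + 1) → ℂ)
    (P : MvPolynomial (Fin (n + 1)) ℂ) : evalPair n M a (C P) = eval a P := by
  simp [evalPair]

theorem evalPair_X (n : ℕ) (M : Matrix (Fin 2) (Fin 2) ℂ) (a : Fin (n + 1) → ℂ)
    (i j : Fin 2) : evalPair n M a (X (i, j)) = M i j := by
  simp [evalPair]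

theorem eq_of_map_eval_eq {σ τ : Type} {F G : MvPolynomial τ (MvPolynomial σ ℂ)}
    (h : ∀ a : σ → ℂ, map (eval a) F = map (eval a) G) : F = G := by
  ext1 m
  refine MvPolynomial.funext fun a => ?_
  rw [← coeff_map, h, coeff_map]

theorem eq_of_evalPair_eq {n : ℕ}
    {F G : MvPolynomial (Fin 2 × Fin 2) (MvPolynomial (Fin (n + 1)) ℂ)}
    (h : ∀ M a, evalPair n M a F = evalPair n M a G) : F = G :=
  eq_of_map_eval_eq fun a => MvPolynomial.funext fun x => h (fun i j => x (i, j)) a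

/-- The coordinates of `f ∘ M` as polynomials in the entries of `M` and the coefficients
of `f`. -/
noncomputable def orbitCoeff (n : ℕ) (i : Fin (n + 1)) :
    MvPolynomial (Fin 2 × Fin 2) (MvPolynomial (Fin (n + 1)) ℂ) :=
  C (C (n.choose (i : ℕ) : ℂ)⁻¹) *
    coeff (Finsupp.single 0 (n - (i : ℕ)) + Finsupp.single 1 (i : ℕ))
      (∑ k : Fin (n + 1), C (C (C (n.choose (k : ℕ) : ℂ) * X k)) *
        (∑ j, C (X ((0 : Fin 2), j)) * X j) ^ (n - (k : ℕ)) *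
        (∑ j, C (X ((1 : Fin 2), j)) * X j) ^ (k : ℕ) :
        MvPolynomial (Fin 2) (MvPolynomial (Fin 2 × Fin 2) (MvPolynomial (Fin (n + 1)) ℂ)))

theorem evalPair_orbitCoeff (n : ℕ) (M : Matrix (Fin 2) (Fin 2) ℂ) (a : Fin (n + 1) → ℂ)
    (i : Fin (n + 1)) : evalPair n M a (orbitCoeff n i) = matAct n M a i := by
  rw [orbitCoeff, map_mul, evalPair_C, eval_C, ← coeff_map, matAct, coeffOf, div_eq_inv_mul]
  congr 2
  simp only [formOf, map_sum, map_mul, map_pow, map_C, map_X, evalPair_X, evalPair_C,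
    eval_C, eval_X, aeval_X, algHom_C, algebraMap_eq, smul_eq_C_mul]

/-- The polynomial `P (f ∘ M)` in the entries of `M` and the coefficients of `f`. -/
noncomputable def orbitMap (n : ℕ) : MvPolynomial (Fin (n + 1)) ℂ →ₐ[ℂ]
    MvPolynomial (Fin 2 × Fin 2) (MvPolynomial (Fin (n + 1)) ℂ) :=
  aeval (orbitCoeff n)

theorem evalPair_orbitMap (n : ℕ) (M : Matrix (Fin 2) (Fin 2) ℂ) (a : Fin (n + 1) → ℂ)
    (P : MvPolynomial (Fin (n + 1)) ℂ) :
    evalPair n M a (orbitMap n P) = eval (matAct n M a) P := by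
  induction P using MvPolynomial.induction_on with
  | C c =>
    rw [orbitMap, algHom_C, eval_C, IsScalarTower.algebraMap_apply ℂ
      (MvPolynomial (Fin (n + 1)) ℂ), algebraMap_eq, algebraMap_eq, evalPair_C, eval_C]
  | add p q hp hq => simp only [map_add, hp, hq]
  | mul_X p i hp =>
    rw [map_mul, map_mul, hp, map_mul, eval_X, ← evalPair_orbitCoeff, orbitMap, aeval_X]

theorem eval_smul_of_isHomogeneous {σ : Type} {p : MvPolynomial σ ℂ} {d : ℕ}
    (hp : p.IsHomogeneous d) (t : ℂ) (x : σ → ℂ) : eval (t • x) p = t ^ d * eval x p := by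
  rw [eval_eq, eval_eq, Finset.mul_sum]
  refine Finset.sum_congr rfl fun m hm => ?_
  rw [hp.degree_eq_sum_deg_support hm, ← Finset.prod_pow_eq_pow_sum]
  simp only [Pi.smul_apply, smul_eq_mul, mul_pow, Finset.prod_mul_distrib]
  ring

theorem eval_smul_eq_sum {σ : Type} (p : MvPolynomial σ ℂ) {N : ℕ} (hN : p.totalDegree < N)
    (t : ℂ) (x : σ → ℂ) :
    eval (t • x) p = ∑ i ∈ Finset.range N, eval x (homogeneousComponent i p) * t ^ i := by
  have h : p = ∑ i ∈ Finset.range N, homogeneousComponent i p := by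
    conv_lhs => rw [← sum_homogeneousComponent p]
    refine Finset.sum_subset (fun i hi => ?_) fun i _ hi => homogeneousComponent_eq_zero _ _ ?_
    · simp only [Finset.mem_range] at hi ⊢; omega
    · simp only [Finset.mem_range] at hi; omega
  conv_lhs => rw [h]
  rw [map_sum]
  refine Finset.sum_congr rfl fun i _ => ?_
  rw [eval_smul_of_isHomogeneous (homogeneousComponent_isHomogeneous i p), mul_comm]

theorem eq_of_sum_mul_pow_eq {N : ℕ} {c d : ℕ → ℂ}
    (h : ∀ t : ℂ, ∑ i ∈ Finset.range N, c i * t ^ i = ∑ i ∈ Finset.range N, d i * t ^ i)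
    {i : ℕ} (hi : i < N) : c i = d i := by
  have key : (∑ i ∈ Finset.range N, Polynomial.C (c i) * Polynomial.X ^ i) =
      ∑ i ∈ Finset.range N, Polynomial.C (d i) * Polynomial.X ^ i :=
    Polynomial.funext fun t => by simpa [Polynomial.eval_finsetSum] using h t
  simpa [Polynomial.finsetSum_coeff, Polynomial.coeff_C_mul, Polynomial.coeff_X_pow, hi] using
    congrArg (fun p => Polynomial.coeff p i) key

theorem isHomogeneous_of_eval_smul {σ : Type} {p : MvPolynomial σ ℂ} {d : ℕ}
    (h : ∀ (t : ℂ) (x : σ → ℂ), eval (t • x) p = t ^ d * eval x p) : p.IsHomogeneous d := by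
  have key : ∀ i, i ≠ d → homogeneousComponent i p = 0 := by
    intro i hi
    by_cases hip : p.totalDegree < i
    · exact homogeneousComponent_eq_zero _ _ hip
    refine MvPolynomial.funext fun x => ?_
    have := eq_of_sum_mul_pow_eq (N := p.totalDegree + d + 1)
      (c := fun i => eval x (homogeneousComponent i p))
      (d := fun i => if i = d then eval x p else 0) (fun t => ?_) (i := i) (by omega)
    · simpa [hi] using this
    · rw [← eval_smul_eq_sum p (by omega) t x, h]
      simp [mul_comm]
  rw [← sum_homogeneousComponent p]
  refine IsHomogeneous.sum _ _ _ fun i _ => ?_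
  by_cases hi : i = d
  · exact hi ▸ homogeneousComponent_isHomogeneous _ _
  · rw [key i hi]; exact isHomogeneous_zero _ _ _

theorem homogeneousComponent_mem_invariantAlgebra {n : ℕ} {P : MvPolynomial (Fin (n + 1)) ℂ}
    (hP : P ∈ invariantAlgebra n) (d : ℕ) : homogeneousComponent d P ∈ invariantAlgebra n := by
  by_cases hd : P.totalDegree < d
  · rw [homogeneousComponent_eq_zero _ _ hd]; exact zero_mem _
  rw [mem_invariantAlgebra_iff] at hP ⊢
  intro g a
  refine eq_of_sum_mul_pow_eq (N := P.totalDegree + 1)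
    (c := fun d => eval (matAct n g.1 a) (homogeneousComponent d P))
    (d := fun d => eval a (homogeneousComponent d P)) (fun t => ?_) (by omega)
  rw [← eval_smul_eq_sum P (by omega), ← eval_smul_eq_sum P (by omega), ← matAct_vec_smul, hP]

theorem evalPair_mat_smul (n : ℕ) (t : ℂ) (M : Matrix (Fin 2) (Fin 2) ℂ) (a : Fin (n + 1) → ℂ)
    {P : MvPolynomial (Fin (n + 1)) ℂ} {d : ℕ} (hP : P.IsHomogeneous d) :
    evalPair n (t • M) a (orbitMap n P) = t ^ (n * d) * evalPair n M a (orbitMap n P) := by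
  rw [evalPair_orbitMap, evalPair_orbitMap, matAct_mat_smul, eval_smul_of_isHomogeneous hP, pow_mul]

theorem orbitMap_isHomogeneous {n d : ℕ} {P : MvPolynomial (Fin (n + 1)) ℂ}
    (hP : P.IsHomogeneous d) : (orbitMap n P).IsHomogeneous (n * d) := by
  have key : ∀ a, (map (eval a) (orbitMap n P)).IsHomogeneous (n * d) := fun a =>
    isHomogeneous_of_eval_smul fun t x => evalPair_mat_smul n t (fun i j => x (i, j)) a hP
  intro m hm
  by_contra hmd
  refine hm (MvPolynomial.funext fun a => ?_)
  rw [← coeff_map, map_zero]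
  by_contra h
  exact hmd ((key a) h)

/-- The determinant of the generic `2 × 2` matrix. -/
noncomputable def genDet (K : Type) [CommRing K] : MvPolynomial (Fin 2 × Fin 2) K :=
  X (0, 0) * X (1, 1) - X (0, 1) * X (1, 0)

theorem evalPair_genDet (n : ℕ) (M : Matrix (Fin 2) (Fin 2) ℂ) (a : Fin (n + 1) → ℂ) :
    evalPair n M a (genDet _) = M.det := by
  simp only [genDet, map_sub, map_mul, evalPair_X, Matrix.det_fin_two]

theorem genDet_isHomogeneous (K : Type) [CommRing K] : (genDet K).IsHomogeneous 2 :=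
  ((isHomogeneous_X K _).mul (isHomogeneous_X K _)).sub
    ((isHomogeneous_X K _).mul (isHomogeneous_X K _))

theorem genDet_ne_zero (n : ℕ) : genDet (MvPolynomial (Fin (n + 1)) ℂ) ≠ 0 := by
  intro h
  have := evalPair_genDet n 1 0
  rw [h] at this
  simp at this

theorem exists_orbitMap_eq {n d : ℕ} {P : MvPolynomial (Fin (n + 1)) ℂ}
    (hP : P ∈ invariantAlgebra n) (hd : P.IsHomogeneous d) :
    ∃ w : ℕ, orbitMap n P = C P * genDet _ ^ w := by
  rw [mem_invariantAlgebra_iff] at hP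
  rcases Nat.even_or_odd (n * d) with ⟨w, hw⟩ | hodd
  · refine ⟨w, mul_right_cancel₀ (genDet_ne_zero n) (eq_of_evalPair_eq fun M a => ?_)⟩
    simp only [map_mul, map_pow, evalPair_genDet, evalPair_C]
    by_cases hM : M.det = 0
    · simp [hM]
    congr 1
    obtain ⟨s, hs⟩ := IsAlgClosed.exists_pow_nat_eq M.det (n := 2) two_pos
    have hs0 : s ≠ 0 := by rintro rfl; exact hM (by simpa using hs.symm)
    have hdet : (s⁻¹ • M).det = 1 := by
      rw [Matrix.det_smul, ← hs, Fintype.card_fin, ← mul_pow, inv_mul_cancel₀ hs0, one_pow]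
    have hMs : M = s • (s⁻¹ • M) := by rw [smul_smul, mul_inv_cancel₀ hs0, one_smul]
    conv_lhs => rw [hMs]
    rw [evalPair_mat_smul n s _ a hd, evalPair_orbitMap, hP ⟨_, hdet⟩ a, ← hs, ← pow_mul,
      mul_comm, hw, two_mul]
  · refine ⟨0, ?_⟩
    suffices P = 0 by simp [this]
    refine MvPolynomial.funext fun a => ?_
    have h1 := hP ⟨(-1 : ℂ) • 1, by simp [Matrix.det_fin_two]⟩ a
    rw [matAct_scalar, eval_smul_of_isHomogeneous hd, ← pow_mul, hodd.neg_one_pow] at h1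
    rw [map_zero]
    linear_combination (-1 / 2 : ℂ) * h1

theorem pderiv_pderiv_comm {σ K : Type} [CommRing K] (i j : σ) (F : MvPolynomial σ K) :
    pderiv i (pderiv j F) = pderiv j (pderiv i F) := by
  classical
  have h : ⁅(pderiv i : Derivation K (MvPolynomial σ K) (MvPolynomial σ K)),
      (pderiv j : Derivation K (MvPolynomial σ K) (MvPolynomial σ K))⁆ = 0 := by
    refine MvPolynomial.derivation_ext fun k => ?_
    rw [Derivation.commutator_apply, pderiv_X, pderiv_X]
    simp [Pi.single_apply, apply_ite (pderiv _)]
  have := congrArg (fun D : Derivation K (MvPolynomial σ K) (MvPolynomial σ K) => D F) h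
  rwa [Derivation.commutator_apply, Derivation.zero_apply, sub_eq_zero] at this

/-- Cayley's `Ω`-process on polynomials in the entries of a `2 × 2` matrix. -/
noncomputable def cayleyOmega (K : Type) [CommRing K] :
    MvPolynomial (Fin 2 × Fin 2) K →ₗ[K] MvPolynomial (Fin 2 × Fin 2) K :=
  (pderiv (0, 0)).toLinearMap ∘ₗ (pderiv (1, 1)).toLinearMap -
    (pderiv (0, 1)).toLinearMap ∘ₗ (pderiv (1, 0)).toLinearMap

theorem cayleyOmega_apply {K : Type} [CommRing K] (F : MvPolynomial (Fin 2 × Fin 2) K) :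
    cayleyOmega K F =
      pderiv (0, 0) (pderiv (1, 1) F) - pderiv (0, 1) (pderiv (1, 0) F) := rfl

/-- The Euler operator on polynomials in the entries of a `2 × 2` matrix. -/
noncomputable def matEuler (K : Type) [CommRing K] (F : MvPolynomial (Fin 2 × Fin 2) K) :
    MvPolynomial (Fin 2 × Fin 2) K :=
  X (0, 0) * pderiv (0, 0) F + X (0, 1) * pderiv (0, 1) F +
    X (1, 0) * pderiv (1, 0) F + X (1, 1) * pderiv (1, 1) F

theorem cayleyOmega_genDet_mul {K : Type} [CommRing K] (F : MvPolynomial (Fin 2 × Fin 2) K) :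
    cayleyOmega K (genDet K * F) = genDet K * cayleyOmega K F + (matEuler K F + 2 * F) := by
  simp only [cayleyOmega_apply, genDet, matEuler, pderiv_mul, map_add, map_sub, pderiv_X,
    Pi.single_apply, Prod.mk.injEq, Fin.isValue, one_ne_zero, zero_ne_one, and_false, false_and,
    and_self, if_true, if_false, map_zero]
  simp only [pderiv_one]
  ring

theorem cayleyOmega_matEuler {K : Type} [CommRing K] (F : MvPolynomial (Fin 2 × Fin 2) K) :
    cayleyOmega K (matEuler K F) = matEuler K (cayleyOmega K F) + 2 * cayleyOmega K F := by
  simp only [cayleyOmega_apply, matEuler, pderiv_mul, map_add, map_sub, pderiv_X,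
    Pi.single_apply, Prod.mk.injEq, Fin.isValue, one_ne_zero, zero_ne_one, and_false, false_and,
    and_self, if_true, if_false, map_zero, pderiv_one]
  have hc := @pderiv_pderiv_comm (Fin 2 × Fin 2) K _
  simp only [hc (1, 1) (0, 0), hc (1, 1) (0, 1), hc (1, 1) (1, 0), hc (1, 0) (0, 0),
    hc (1, 0) (0, 1), hc (0, 1) (0, 0)]
  ring

theorem constantCoeff_matEuler {K : Type} [CommRing K] (F : MvPolynomial (Fin 2 × Fin 2) K) :
    constantCoeff (matEuler K F) = 0 := by
  simp [matEuler]

theorem constantCoeff_genDet {K : Type} [CommRing K] : constantCoeff (genDet K) = 0 := by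
  simp [genDet]

theorem cayleyOmega_pow_genDet_mul {K : Type} [CommRing K] (p : ℕ)
    (F : MvPolynomial (Fin 2 × Fin 2) K) :
    (cayleyOmega K ^ (p + 1)) (genDet K * F) = genDet K * (cayleyOmega K ^ (p + 1)) F +
      (p + 1 : ℕ) • (matEuler K ((cayleyOmega K ^ p) F) +
        (p + 2 : ℕ) • (cayleyOmega K ^ p) F) := by
  induction p with
  | zero => simp [cayleyOmega_genDet_mul, two_mul, two_smul]
  | succ p ih =>
    rw [pow_succ', Module.End.mul_apply, ih, map_add, cayleyOmega_genDet_mul, map_nsmul,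
      map_add, map_nsmul, cayleyOmega_matEuler, ← Module.End.mul_apply, ← pow_succ',
      ← Module.End.mul_apply, ← pow_succ']
    simp only [nsmul_eq_mul]
    push_cast
    ring

theorem constantCoeff_cayleyOmega_pow_genDet_mul {K : Type} [CommRing K] (p : ℕ)
    (F : MvPolynomial (Fin 2 × Fin 2) K) :
    constantCoeff ((cayleyOmega K ^ (p + 1)) (genDet K * F)) =
      ((p + 1) * (p + 2) : ℕ) * constantCoeff ((cayleyOmega K ^ p) F) := by
  rw [cayleyOmega_pow_genDet_mul, map_add, map_mul, constantCoeff_genDet, zero_mul, zero_add,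
    map_nsmul, map_add, map_nsmul, constantCoeff_matEuler, zero_add, smul_smul, nsmul_eq_mul]

/-- The truncation at order `N` of the invariant integral over `SL₂` of a polynomial in the
matrix entries, expressed through Cayley's `Ω`-process. -/
noncomputable def cayleyIntegral {K : Type} [CommRing K] [Algebra ℂ K] (N : ℕ)
    (F : MvPolynomial (Fin 2 × Fin 2) K) : K :=
  ∑ p ∈ Finset.range N, algebraMap ℂ K ((p.factorial * (p + 1).factorial : ℕ) : ℂ)⁻¹ *
    constantCoeff ((cayleyOmega K ^ p) F)

section

variable {K : Type} [CommRing K] [Algebra ℂ K]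

theorem cayleyIntegral_sum {ι : Type} (s : Finset ι) (N : ℕ)
    (F : ι → MvPolynomial (Fin 2 × Fin 2) K) :
    cayleyIntegral N (∑ i ∈ s, F i) = ∑ i ∈ s, cayleyIntegral N (F i) := by
  simp only [cayleyIntegral, map_sum, Finset.mul_sum]
  exact Finset.sum_comm

theorem cayleyIntegral_C_mul (N : ℕ) (c : K) (F : MvPolynomial (Fin 2 × Fin 2) K) :
    cayleyIntegral N (C c * F) = c * cayleyIntegral N F := by
  simp only [cayleyIntegral, ← smul_eq_C_mul, map_smul, constantCoeff_smul, smul_eq_mul,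
    Finset.mul_sum]
  exact Finset.sum_congr rfl fun _ _ => mul_left_comm _ _ _

theorem cayleyIntegral_one {N : ℕ} (hN : 0 < N) :
    cayleyIntegral N (1 : MvPolynomial (Fin 2 × Fin 2) K) = 1 := by
  obtain ⟨N, rfl⟩ : ∃ M, N = M + 1 := ⟨N - 1, by omega⟩
  rw [cayleyIntegral, Finset.sum_range_succ', Finset.sum_eq_zero]
  · simp
  · intro p _
    have : cayleyOmega K 1 = 0 := by simp [cayleyOmega_apply]
    rw [pow_succ, Module.End.mul_apply, this]
    simp

theorem cayleyIntegral_genDet_mul (N : ℕ) (F : MvPolynomial (Fin 2 × Fin 2) K) :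
    cayleyIntegral (N + 1) (genDet K * F) = cayleyIntegral N F := by
  rw [cayleyIntegral, Finset.sum_range_succ', cayleyIntegral]
  simp only [pow_zero, Module.End.one_apply, map_mul, constantCoeff_genDet, zero_mul, mul_zero,
    add_zero]
  refine Finset.sum_congr rfl fun p _ => ?_
  rw [constantCoeff_cayleyOmega_pow_genDet_mul, ← mul_assoc]
  congr 1
  rw [← map_natCast (algebraMap ℂ K), ← map_mul]
  congr 1
  rw [Nat.factorial_succ (p + 1), Nat.factorial_succ p]
  have := p.factorial_ne_zero
  have h1 : (p : ℂ) + 1 ≠ 0 := by exact_mod_cast p.succ_ne_zero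
  have h2 : (p : ℂ) + 2 ≠ 0 := by exact_mod_cast (p + 1).succ_ne_zero
  push_cast
  have h3 : (p : ℂ) + 1 + 1 ≠ 0 := by rw [add_assoc]; norm_num [h2]
  field_simp
  ring

theorem cayleyIntegral_genDet_pow_mul (N w : ℕ) (F : MvPolynomial (Fin 2 × Fin 2) K) :
    cayleyIntegral (N + w) (genDet K ^ w * F) = cayleyIntegral N F := by
  induction w with
  | zero => simp
  | succ w ih => rw [pow_succ', mul_assoc, ← add_assoc, cayleyIntegral_genDet_mul, ih]

end

theorem map_cayleyIntegral {K L : Type} [CommRing K] [Algebra ℂ K] [CommRing L] [Algebra ℂ L]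
    (f : K →ₐ[ℂ] L) (N : ℕ) (F : MvPolynomial (Fin 2 × Fin 2) K) :
    f (cayleyIntegral N F) = cayleyIntegral N (map (f : K →+* L) F) := by
  have h : ∀ p : ℕ, (cayleyOmega L ^ p) (map (f : K →+* L) F) =
      map (f : K →+* L) ((cayleyOmega K ^ p) F) := by
    intro p
    induction p with
    | zero => rfl
    | succ p ih =>
      rw [pow_succ', Module.End.mul_apply, ih, pow_succ', Module.End.mul_apply,
        cayleyOmega_apply, cayleyOmega_apply, map_sub, pderiv_map, pderiv_map, pderiv_map,
        pderiv_map]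
  simp only [cayleyIntegral, map_sum, map_mul, AlgHom.commutes, h, constantCoeff_map]
  rfl

/-- The substitution `g ↦ h * g` on polynomials in the entries of a `2 × 2` matrix `g`. -/
noncomputable def leftTranslate (h : Matrix (Fin 2) (Fin 2) ℂ) :
    MvPolynomial (Fin 2 × Fin 2) ℂ →ₐ[ℂ] MvPolynomial (Fin 2 × Fin 2) ℂ :=
  aeval fun p => ∑ k, C (h p.1 k) * X (k, p.2)

theorem pderiv_leftTranslate (h : Matrix (Fin 2) (Fin 2) ℂ) (i j : Fin 2)
    (F : MvPolynomial (Fin 2 × Fin 2) ℂ) :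
    pderiv (i, j) (leftTranslate h F) =
      ∑ k, C (h k i) * leftTranslate h (pderiv (k, j) F) := by
  induction F using MvPolynomial.induction_on with
  | C c => simp [leftTranslate, algHom_C]
  | add p q hp hq => simp only [map_add, hp, hq, mul_add, Finset.sum_add_distrib]
  | mul_X p x hp =>
    obtain ⟨r, s⟩ := x
    rw [map_mul, pderiv_mul, hp]
    simp only [pderiv_mul, map_add, map_mul, Fin.sum_univ_two]
    have hX : leftTranslate h (X (r, s)) = C (h r 0) * X (0, s) + C (h r 1) * X (1, s) := by
      simp [leftTranslate]
    rw [hX]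
    fin_cases i <;> fin_cases j <;> fin_cases r <;> fin_cases s <;>
      simp [pderiv_X] <;> ring

theorem cayleyOmega_leftTranslate (h : Matrix (Fin 2) (Fin 2) ℂ)
    (F : MvPolynomial (Fin 2 × Fin 2) ℂ) :
    cayleyOmega ℂ (leftTranslate h F) = C h.det * leftTranslate h (cayleyOmega ℂ F) := by
  simp only [cayleyOmega_apply, pderiv_leftTranslate, Fin.sum_univ_two, map_add, pderiv_C_mul,
    map_sub, Matrix.det_fin_two, map_mul]
  have hc := @pderiv_pderiv_comm (Fin 2 × Fin 2) ℂ _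
  simp only [hc (1, 1) (0, 0), hc (1, 1) (1, 0), hc (1, 0) (0, 1), hc (0, 1) (0, 0)]
  ring

theorem constantCoeff_leftTranslate (h : Matrix (Fin 2) (Fin 2) ℂ)
    (F : MvPolynomial (Fin 2 × Fin 2) ℂ) :
    constantCoeff (leftTranslate h F) = constantCoeff F := by
  induction F using MvPolynomial.induction_on with
  | C c => simp [leftTranslate, algHom_C]
  | add p q hp hq => simp only [map_add, hp, hq]
  | mul_X p x hp => simp [leftTranslate]

theorem cayleyIntegral_leftTranslate {h : Matrix (Fin 2) (Fin 2) ℂ} (hh : h.det = 1) (N : ℕ)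
    (F : MvPolynomial (Fin 2 × Fin 2) ℂ) :
    cayleyIntegral N (leftTranslate h F) = cayleyIntegral N F := by
  have key : ∀ p : ℕ, (cayleyOmega ℂ ^ p) (leftTranslate h F) =
      leftTranslate h ((cayleyOmega ℂ ^ p) F) := by
    intro p
    induction p with
    | zero => rfl
    | succ p ih =>
      rw [pow_succ', Module.End.mul_apply, ih, cayleyOmega_leftTranslate, hh, map_one, one_mul,
        Module.End.mul_apply]
  simp only [cayleyIntegral, key, constantCoeff_leftTranslate]

theorem leftTranslate_map_orbitMap (n : ℕ) (h : Matrix (Fin 2) (Fin 2) ℂ) (a : Fin (n + 1) → ℂ)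
    (P : MvPolynomial (Fin (n + 1)) ℂ) :
    leftTranslate h (map (eval a) (orbitMap n P)) =
      map (eval (matAct n h a)) (orbitMap n P) := by
  refine MvPolynomial.funext fun x => ?_
  have h1 : eval x (map (eval (matAct n h a)) (orbitMap n P)) =
      evalPair n (Matrix.of fun i j => x (i, j)) (matAct n h a) (orbitMap n P) := rfl
  have h2 : eval x (leftTranslate h (map (eval a) (orbitMap n P))) =
      evalPair n (h * Matrix.of fun i j => x (i, j)) a (orbitMap n P) := by
    rw [evalPair, RingHom.comp_apply, leftTranslate, ← coe_aeval_eq_eval, RingHom.coe_coe,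
      ← AlgHom.comp_apply, comp_aeval]
    simp [aeval_eq_eval, Matrix.mul_apply]
  rw [h1, h2, evalPair_orbitMap, evalPair_orbitMap, matAct_matAct]

theorem cayleyIntegral_orbitMap_mem (n N : ℕ) (P : MvPolynomial (Fin (n + 1)) ℂ) :
    cayleyIntegral N (orbitMap n P) ∈ invariantAlgebra n := by
  rw [mem_invariantAlgebra_iff]
  intro g a
  have h := fun b : Fin (n + 1) → ℂ => map_cayleyIntegral (aeval b) N (orbitMap n P)
  simp only [aeval_eq_eval, coe_aeval_eq_eval] at h
  rw [h, h, ← leftTranslate_map_orbitMap, cayleyIntegral_leftTranslate g.2]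

theorem homogeneousComponent_mul_of_isHomogeneous {σ : Type} {p q : MvPolynomial σ ℂ} {d : ℕ}
    (hp : p.IsHomogeneous d) (D : ℕ) :
    homogeneousComponent D (p * q) = if d ≤ D then p * homogeneousComponent (D - d) q else 0 := by
  let _ : GradedAlgebra (homogeneousSubmodule σ ℂ) := MvPolynomial.gradedAlgebra
  have h := DirectSum.coe_decompose_mul_of_left_mem (homogeneousSubmodule σ ℂ) (b := q) D
    ((mem_homogeneousSubmodule _ _).2 hp)
  simp only [← decomposition.decompose'_apply]
  exact h

/-- An invariant lying in an ideal generated by homogeneous invariants is a combination of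
the generators with homogeneous invariant coefficients. -/
theorem exists_invariant_coefficients {n : ℕ} {ι : Type} [Fintype ι]
    {f h : ι → MvPolynomial (Fin (n + 1)) ℂ} {d : ι → ℕ} (hf : ∀ i, f i ∈ invariantAlgebra n)
    (hfd : ∀ i, (f i).IsHomogeneous (d i)) {s : MvPolynomial (Fin (n + 1)) ℂ} {D : ℕ}
    (hs : s ∈ invariantAlgebra n) (hsD : s.IsHomogeneous D) (hsum : s = ∑ i, f i * h i) :
    ∃ c : ι → MvPolynomial (Fin (n + 1)) ℂ, (∀ i, c i ∈ invariantAlgebra n) ∧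
      (∀ i, (c i).IsHomogeneous (D - d i)) ∧ s = ∑ i, f i * c i := by
  obtain ⟨w, hw⟩ := exists_orbitMap_eq hs hsD
  choose u hu using fun i => exists_orbitMap_eq (hf i) (hfd i)
  have hle : ∀ i, u i ≤ ∑ j, u j := fun i =>
    Finset.single_le_sum (fun _ _ => Nat.zero_le _) (Finset.mem_univ i)
  set N := (1 + ∑ i, u i) + w with hN
  have key : s = ∑ i, f i * cayleyIntegral (N - u i) (orbitMap n (h i)) := by
    have h1 : cayleyIntegral N (orbitMap n s) = s := by
      rw [hw, cayleyIntegral_C_mul, ← mul_one (genDet _ ^ w), hN, cayleyIntegral_genDet_pow_mul,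
        cayleyIntegral_one (by omega), mul_one]
    conv_lhs => rw [← h1, hsum, map_sum, cayleyIntegral_sum]
    refine Finset.sum_congr rfl fun i _ => ?_
    have h2 : N = (N - u i) + u i := by have := hle i; omega
    rw [map_mul, hu, mul_assoc, cayleyIntegral_C_mul]
    conv_lhs => rw [h2, cayleyIntegral_genDet_pow_mul]
  refine ⟨fun i => if d i ≤ D then homogeneousComponent (D - d i)
    (cayleyIntegral (N - u i) (orbitMap n (h i))) else 0, fun i => ?_, fun i => ?_, ?_⟩
  · dsimp only
    split_ifs
    · exact homogeneousComponent_mem_invariantAlgebra (cayleyIntegral_orbitMap_mem _ _ _) _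
    · exact zero_mem _
  · dsimp only
    split_ifs
    · exact homogeneousComponent_isHomogeneous _ _
    · exact isHomogeneous_zero _ _ _
  · conv_lhs => rw [← homogeneousComponent_eq_self ((mem_homogeneousSubmodule _ _).2 hsD), key]
    rw [map_sum]
    refine Finset.sum_congr rfl fun i _ => ?_
    rw [homogeneousComponent_mul_of_isHomogeneous (hfd i), mul_ite, mul_zero]

/-- The invariants that are homogeneous of positive degree. -/
def positiveInvariants (n : ℕ) : Set (MvPolynomial (Fin (n + 1)) ℂ) :=
  {P | P ∈ invariantAlgebra n ∧ ∃ d : ℕ, 0 < d ∧ P.IsHomogeneous d}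

theorem exists_mem_span_positiveInvariants_pow (n : ℕ) :
    ∃ e : ℕ, ∀ (m D : ℕ) (s : MvPolynomial (Fin (n + 1)) ℂ), s ∈ invariantAlgebra n →
      s.IsHomogeneous D → m * e + 1 ≤ D → s ∈ Ideal.span (positiveInvariants n) ^ m := by
  obtain ⟨T, hT, hspan⟩ := (Submodule.fg_span_iff_fg_span_finset_subset
    (positiveInvariants n)).1 (IsNoetherian.noetherian (Ideal.span (positiveInvariants n)))
  choose d hd0 hd using fun P : T => (hT P.2).2
  refine ⟨∑ P, d P, fun m => ?_⟩
  induction m with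
  | zero => simp
  | succ m ih =>
    intro D s hs hsD hD
    have hsI : s ∈ Ideal.span (positiveInvariants n) :=
      Ideal.subset_span ⟨hs, D, by omega, hsD⟩
    have hrange : (T : Set (MvPolynomial (Fin (n + 1)) ℂ)) = Set.range fun P : T => P.1 := by
      simp
    rw [Ideal.span, hspan, ← Ideal.span, hrange, Ideal.mem_span_range_iff_exists_fun] at hsI
    obtain ⟨h, hh⟩ := hsI
    obtain ⟨c, hc, hcd, hsum⟩ := exists_invariant_coefficients (fun P : T => (hT P.2).1) hd hs hsD
      (hh.symm.trans (Finset.sum_congr rfl fun P _ => mul_comm (h P) P.1))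
    rw [hsum, pow_succ']
    refine sum_mem fun P _ => Ideal.mul_mem_mul (Ideal.subset_span (hT P.2))
      (ih _ _ (hc P) (hcd P) ?_)
    have : d P ≤ ∑ P, d P := Finset.single_le_sum (fun _ _ => Nat.zero_le _) (Finset.mem_univ P)
    rw [add_mul, one_mul] at hD
    omega

theorem exists_mem_span_of_zeroLocus_subset_nullcone {n : ℕ} {ι : Type}
    {v : ι → MvPolynomial (Fin (n + 1)) ℂ}
    (h : {a : Fin (n + 1) → ℂ | ∀ j, eval a (v j) = 0} ⊆ nullcone n) :
    ∃ B : ℕ, ∀ (D : ℕ) (s : MvPolynomial (Fin (n + 1)) ℂ), s ∈ invariantAlgebra n →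
      s.IsHomogeneous D → B ≤ D → s ∈ Ideal.span (Set.range v) := by
  have hrad : Ideal.span (positiveInvariants n) ≤ (Ideal.span (Set.range v)).radical := by
    rw [Ideal.span_le]
    rintro P ⟨hP, d, hd0, hd⟩
    rw [SetLike.mem_coe, ← vanishingIdeal_zeroLocus_eq_radical (K := ℂ), mem_vanishingIdeal_iff]
    intro a ha
    rw [zeroLocus_span] at ha
    rw [aeval_eq_eval]
    refine h (fun j => ?_) P hP d hd0 hd
    have := ha (v j) ⟨j, rfl⟩
    rwa [aeval_eq_eval] at this
  obtain ⟨k, hk⟩ := Ideal.exists_pow_le_of_le_radical_of_fg hrad (IsNoetherian.noetherian _)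
  obtain ⟨e, he⟩ := exists_mem_span_positiveInvariants_pow n
  exact ⟨k * e + 1, fun D s hs hsD hD => hk (he k D s hs hsD hD)⟩

theorem exists_finset_span_of_zeroLocus_subset_nullcone {n : ℕ} {ι : Type} [Fintype ι]
    {v : ι → MvPolynomial (Fin (n + 1)) ℂ} (hinv : ∀ j, v j ∈ invariantAlgebra n)
    (hhom : ∀ j, ∃ d : ℕ, 0 < d ∧ (v j).IsHomogeneous d)
    (h : {a : Fin (n + 1) → ℂ | ∀ j, eval a (v j) = 0} ⊆ nullcone n) :
    ∃ F : Finset (MvPolynomial (Fin (n + 1)) ℂ),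
      (F : Set (MvPolynomial (Fin (n + 1)) ℂ)) ⊆
        (invariantAlgebra n : Set (MvPolynomial (Fin (n + 1)) ℂ)) ∧
      ∀ x ∈ invariantAlgebra n, x ∈ Submodule.span (Algebra.adjoin ℂ (Set.range v))
        (F : Set (MvPolynomial (Fin (n + 1)) ℂ)) := by
  obtain ⟨B, hB⟩ := exists_mem_span_of_zeroLocus_subset_nullcone h
  choose d hd0 hd using hhom
  set W := Subalgebra.toSubmodule (invariantAlgebra n) ⊓ restrictTotalDegree (Fin (n + 1)) ℂ B
  have hW : W.FG := by
    have : FiniteDimensional ℂ W := Submodule.finiteDimensional_of_le inf_le_right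
    exact Module.Finite.iff_fg.1 this
  obtain ⟨F, hF⟩ := hW
  have hFW : (F : Set (MvPolynomial (Fin (n + 1)) ℂ)) ⊆ W := hF ▸ Submodule.subset_span
  refine ⟨F, fun x hx => (hFW hx).1, ?_⟩
  have hom : ∀ (D : ℕ) (s : MvPolynomial (Fin (n + 1)) ℂ), s ∈ invariantAlgebra n →
      s.IsHomogeneous D → s ∈ Submodule.span (Algebra.adjoin ℂ (Set.range v))
        (F : Set (MvPolynomial (Fin (n + 1)) ℂ)) := by
    intro D
    induction D using Nat.strong_induction_on with
    | _ D ih =>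
      intro s hs hsD
      rcases le_or_gt D B with hDB | hDB
      · have hsW : s ∈ W := ⟨hs, (mem_restrictTotalDegree _ _ _).2
          (hsD.totalDegree_le.trans hDB)⟩
        rw [← hF] at hsW
        exact Submodule.span_le_restrictScalars ℂ (Algebra.adjoin ℂ (Set.range v)) _ hsW
      · obtain ⟨g, hg⟩ := Ideal.mem_span_range_iff_exists_fun.1 (hB D s hs hsD hDB.le)
        obtain ⟨c, hc, hcd, hsum⟩ := exists_invariant_coefficients hinv hd hs hsD
          (hg.symm.trans (Finset.sum_congr rfl fun j _ => mul_comm (g j) (v j)))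
        rw [hsum]
        refine sum_mem fun j _ => ?_
        have := ih (D - d j) (by have := hd0 j; omega) (c j) (hc j) (hcd j)
        exact Submodule.smul_mem _ (⟨v j, Algebra.subset_adjoin ⟨j, rfl⟩⟩ :
          Algebra.adjoin ℂ (Set.range v)) this
  intro x hx
  rw [← sum_homogeneousComponent x]
  exact sum_mem fun i _ => hom i _ (homogeneousComponent_mem_invariantAlgebra hx i)
    (homogeneousComponent_isHomogeneous _ _)

theorem isIntegral_of_subalgebra_le_span {K R : Type} [Field K] [CommRing R] [IsDomain R]
    [Algebra K R] {S A : Subalgebra K R} (hA : A ≤ S) {F : Finset R} (hFS : (F : Set R) ⊆ S)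
    (hF : ∀ x ∈ S, x ∈ Submodule.span A (F : Set R)) {x : R} (hx : x ∈ S) : IsIntegral A x := by
  have hS : ∀ y ∈ Submodule.span A (F : Set R), y ∈ S := by
    intro y hy
    induction hy using Submodule.span_induction with
    | mem y hy => exact hFS hy
    | zero => exact zero_mem _
    | add y z _ _ hy hz => exact add_mem hy hz
    | smul a y _ hy => exact mul_mem (hA a.2) hy
  refine isIntegral_of_smul_mem_submodule (Submodule.span A (F : Set R)) ?_ ⟨F, rfl⟩ x
    fun y hy => hF _ (mul_mem hx (hS y hy))
  exact (Submodule.ne_bot_iff _).2 ⟨1, hF 1 (one_mem _), one_ne_zero⟩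

theorem zeroLocus_subset_nullcone_of_isHSOP {n : ℕ} {ι : Type} [Fintype ι]
    {v : ι → MvPolynomial (Fin (n + 1)) ℂ}
    (hhom : ∀ j, ∃ d : ℕ, 0 < d ∧ (v j).IsHomogeneous d) (h : IsHSOP n v) :
    {a : Fin (n + 1) → ℂ | ∀ j, eval a (v j) = 0} ⊆ nullcone n := by
  obtain ⟨hinv, -, -, F, hFS, hF⟩ := h
  intro a ha P hP d hd0 hd
  have hA : Algebra.adjoin ℂ (Set.range v) ≤ invariantAlgebra n :=
    Algebra.adjoin_le (Set.range_subset_iff.2 hinv)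
  obtain ⟨p, hp, hpP⟩ := isIntegral_of_subalgebra_le_span hA hFS hF hP
  have hconst : ∀ x ∈ Algebra.adjoin ℂ (Set.range v), ∀ t : ℂ,
      eval (t • a) x = eval a x := by
    intro x hx t
    induction hx using Algebra.adjoin_induction with
    | mem x hx =>
      obtain ⟨j, rfl⟩ := hx
      obtain ⟨e, -, he⟩ := hhom j
      rw [eval_smul_of_isHomogeneous he, ha j, mul_zero]
    | algebraMap r => simp [algebraMap_eq]
    | add x y _ _ hx hy => rw [map_add, map_add, hx, hy]
    | mul x y _ _ hx hy => rw [map_mul, map_mul, hx, hy]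
  let q : Polynomial ℂ := p.map ((eval a).comp (Algebra.adjoin ℂ (Set.range v)).val.toRingHom)
  have hq : q ≠ 0 := (hp.map _).ne_zero
  have hroot : ∀ t : ℂ, q.eval (t ^ d * eval a P) = 0 := by
    intro t
    have h1 := congrArg (eval (t • a)) hpP
    rw [Polynomial.hom_eval₂, map_zero, eval_smul_of_isHomogeneous hd] at h1
    rw [Polynomial.eval_map, ← h1]
    congr 1
    ext x
    exact (hconst x.1 x.2 t).symm
  by_contra hPa
  refine hq (Polynomial.eq_zero_of_infinite_isRoot q (Set.infinite_univ.mono fun z _ => ?_))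
  obtain ⟨t, ht⟩ := IsAlgClosed.exists_pow_nat_eq (z / eval a P) hd0
  have := hroot t
  rwa [ht, div_mul_cancel₀ _ hPa] at this

theorem exists_proportional_relation {G R ι : Type} [Group G] [CommRing R] [IsDomain R]
    [Fintype ι] (σ : G →* (R →+* R)) (y : ι → R) {x : ι → R} (hx : x ≠ 0)
    (hxy : ∀ g, ∑ i, x i * σ g (y i) = 0) :
    ∃ (z : ι → R) (i₀ : ι), z i₀ ≠ 0 ∧ (∀ g, ∑ i, z i * σ g (y i) = 0) ∧
      ∀ g i, z i₀ * σ g (z i) = σ g (z i₀) * z i := by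
  classical
  have hex : ∃ k, ∃ z : ι → R, z ≠ 0 ∧ (∀ g, ∑ i, z i * σ g (y i) = 0) ∧
      (Finset.univ.filter fun i => z i ≠ 0).card = k := ⟨_, x, hx, hxy, rfl⟩
  obtain ⟨z, hz, hzy, hcard⟩ := Nat.find_spec hex
  obtain ⟨i₀, hi₀⟩ := Function.ne_iff.1 hz
  refine ⟨z, i₀, hi₀, hzy, fun h => ?_⟩
  by_contra! hne
  obtain ⟨j, hj⟩ := hne
  refine Nat.find_min hex (m := (Finset.univ.filter fun i =>
    z i₀ * σ h (z i) - σ h (z i₀) * z i ≠ 0).card) ?_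
    ⟨fun i => z i₀ * σ h (z i) - σ h (z i₀) * z i,
      Function.ne_iff.2 ⟨j, sub_ne_zero.2 hj⟩, fun g => ?_, rfl⟩
  · rw [← hcard]
    refine Finset.card_lt_card (Finset.ssubset_iff_subset_ne.2 ⟨fun i hi => ?_, fun heq => ?_⟩)
    · simp only [Finset.mem_filter, Finset.mem_univ, true_and] at hi ⊢
      rintro h0
      simp [h0] at hi
    · have : i₀ ∈ Finset.univ.filter fun i => z i ≠ 0 := by simpa using hi₀
      rw [← heq] at this
      simp [mul_comm] at this
  · have h1 : ∑ i, σ h (z i) * σ g (y i) = 0 := by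
      have h2 := congrArg (σ h) (hzy (h⁻¹ * g))
      rw [map_sum, map_zero] at h2
      rw [← h2]
      refine Finset.sum_congr rfl fun i _ => ?_
      rw [map_mul, ← RingHom.comp_apply, ← RingHom.mul_def, ← map_mul, mul_inv_cancel_left]
    simp only [sub_mul, Finset.sum_sub_distrib, mul_assoc, ← Finset.mul_sum, h1, hzy, mul_zero,
      sub_zero]

theorem fixed_of_dvd {G R : Type} [Group G] (hG : commutator G = ⊤) [CommRing R] [IsDomain R]
    (σ : G →* (R →+* R)) (hunit : ∀ g (u : Rˣ), σ g u = u) {q : R}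
    (hq : ∀ g, q ∣ σ g q) (g : G) : σ g q = q := by
  rcases eq_or_ne q 0 with rfl | hq0
  · simp
  choose c hc using hq
  have hmul : ∀ g h, c (g * h) = c g * σ g (c h) := by
    intro g h
    refine mul_left_cancel₀ hq0 ?_
    rw [← hc, map_mul, RingHom.mul_def, RingHom.comp_apply, hc h, map_mul, hc g, mul_assoc]
  have hone : c 1 = 1 := by
    refine mul_left_cancel₀ hq0 ?_
    rw [← hc, map_one, RingHom.one_def, RingHom.id_apply, mul_one]
  have hcu : ∀ g, IsUnit (c g) := by
    intro g
    refine IsUnit.of_mul_eq_one (σ g (c g⁻¹)) ?_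
    rw [← hmul, mul_inv_cancel, hone]
  let χ : G →* R :=
    { toFun := c
      map_one' := hone
      map_mul' := fun g h => by
        obtain ⟨u, hu⟩ := hcu h
        rw [hmul, ← hu, hunit] }
  have hker : g ∈ χ.toHomUnits.ker :=
    Abelianization.commutator_subset_ker χ.toHomUnits (hG ▸ Subgroup.mem_top g)
  have h1 : c g = 1 := congrArg Units.val (MonoidHom.mem_ker.1 hker)
  rw [hc g, h1, mul_one]

theorem exists_fixed_relation {G R ι : Type} [Group G] (hG : commutator G = ⊤) [CommRing R]
    [IsDomain R] [UniqueFactorizationMonoid R] [Fintype ι] (σ : G →* (R →+* R))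
    (hunit : ∀ g (u : Rˣ), σ g u = u) (y : ι → R) {x : ι → R} (hx : x ≠ 0)
    (hxy : ∀ g, ∑ i, x i * σ g (y i) = 0) :
    ∃ s : ι → R, s ≠ 0 ∧ (∀ g i, σ g (s i) = s i) ∧ ∑ i, s i * y i = 0 := by
  obtain ⟨z, i₀, hz₀, hzy, hprop⟩ := exists_proportional_relation σ y hx hxy
  obtain ⟨inst⟩ : Nonempty (NormalizedGCDMonoid R) := inferInstance
  obtain ⟨s, hs, hgcd⟩ := Finset.extract_gcd z (s := Finset.univ) ⟨i₀, Finset.mem_univ _⟩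
  set c := Finset.univ.gcd z
  replace hs : ∀ i, z i = c * s i := fun i => hs i (Finset.mem_univ i)
  have hc : c ≠ 0 := fun h => hz₀ (by rw [hs, h, zero_mul])
  have hs₀ : s i₀ ≠ 0 := fun h => hz₀ (by rw [hs, h, mul_zero])
  have hinj : ∀ g, Function.Injective (σ g) := fun g =>
    Function.LeftInverse.injective (g := σ g⁻¹) fun r => by
      rw [← RingHom.comp_apply, ← RingHom.mul_def, ← map_mul, inv_mul_cancel, map_one,
        RingHom.one_def,
        RingHom.id_apply]
  have hprop' : ∀ g i, s i₀ * σ g (s i) = σ g (s i₀) * s i := by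
    intro g i
    have h := hprop g i
    rw [hs i, hs i₀, map_mul, map_mul] at h
    have hσc : σ g c ≠ 0 := (map_ne_zero_iff _ (hinj g)).2 hc
    refine mul_left_cancel₀ (mul_ne_zero hc hσc) ?_
    linear_combination h
  have hfix : ∀ g, σ g (s i₀) = s i₀ := by
    refine fixed_of_dvd hG σ hunit fun g => ?_
    have h : s i₀ ∣ Finset.univ.gcd fun i => σ g (s i₀) * s i :=
      Finset.dvd_gcd fun i _ => ⟨_, (hprop' g i).symm⟩
    rwa [(Finset.gcd_mul_left' _ _ _).dvd_iff_dvd_right, hgcd, mul_one] at h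
  refine ⟨s, fun h => hs₀ (congrFun h i₀), fun g i => mul_left_cancel₀ hs₀ ?_,
    mul_left_cancel₀ hc ?_⟩
  · rw [hprop', hfix]
  · rw [Finset.mul_sum, mul_zero, ← hzy 1]
    simp [hs, mul_assoc]

/-- The ring endomorphism `P ↦ (f ↦ P (f ∘ M))` of the coordinate ring of `Vₙ`. -/
noncomputable def matSubst (n : ℕ) (M : Matrix (Fin 2) (Fin 2) ℂ) :
    MvPolynomial (Fin (n + 1)) ℂ →+* MvPolynomial (Fin (n + 1)) ℂ :=
  (eval fun p : Fin 2 × Fin 2 => C (M p.1 p.2)).comp (orbitMap n).toRingHom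

theorem eval_eval_C (n : ℕ) (M : Matrix (Fin 2) (Fin 2) ℂ) (a : Fin (n + 1) → ℂ)
    (F : MvPolynomial (Fin 2 × Fin 2) (MvPolynomial (Fin (n + 1)) ℂ)) :
    eval a (eval (fun p : Fin 2 × Fin 2 => C (M p.1 p.2)) F) = evalPair n M a F := by
  induction F using MvPolynomial.induction_on with
  | C c => rw [eval_C, evalPair_C]
  | add p q hp hq => simp only [map_add, hp, hq]
  | mul_X p x hp => rw [map_mul, map_mul, map_mul, hp, eval_X, eval_C, evalPair_X]

theorem eval_matSubst (n : ℕ) (M : Matrix (Fin 2) (Fin 2) ℂ) (a : Fin (n + 1) → ℂ)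
    (P : MvPolynomial (Fin (n + 1)) ℂ) :
    eval a (matSubst n M P) = eval (matAct n M a) P := by
  rw [← evalPair_orbitMap, ← eval_eval_C]
  rfl

/-- The action of `SL₂(ℂ)` on the coordinate ring of `Vₙ` by ring endomorphisms. -/
noncomputable def slSubst (n : ℕ) : Matrix.SpecialLinearGroup (Fin 2) ℂ →*
    (MvPolynomial (Fin (n + 1)) ℂ →+* MvPolynomial (Fin (n + 1)) ℂ) where
  toFun g := matSubst n g.1
  map_one' := RingHom.ext fun P => MvPolynomial.funext fun a => by
    rw [eval_matSubst]
    simp [matAct_one]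
  map_mul' g h := RingHom.ext fun P => MvPolynomial.funext fun a => by
    rw [RingHom.mul_def, RingHom.comp_apply, eval_matSubst, eval_matSubst, eval_matSubst,
      matAct_matAct, Matrix.SpecialLinearGroup.coe_mul]

theorem slSubst_unit (n : ℕ) (g : Matrix.SpecialLinearGroup (Fin 2) ℂ)
    (u : (MvPolynomial (Fin (n + 1)) ℂ)ˣ) : slSubst n g u = u := by
  obtain ⟨r, -, hr⟩ := isUnit_iff_eq_C_of_isReduced.1 u.isUnit
  rw [hr]
  refine MvPolynomial.funext fun a => ?_
  exact (eval_matSubst n g.1 a _).trans (by rw [eval_C, eval_C])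

theorem mem_invariantAlgebra_iff_slSubst {n : ℕ} {P : MvPolynomial (Fin (n + 1)) ℂ} :
    P ∈ invariantAlgebra n ↔ ∀ g, slSubst n g P = P := by
  rw [mem_invariantAlgebra_iff]
  refine forall_congr' fun g => ⟨fun h => MvPolynomial.funext fun a => ?_, fun h a => ?_⟩
  · exact (eval_matSubst n g.1 a P).trans (h a)
  · rw [← eval_matSubst]
    exact congrArg (eval a) h

/-- The exponent vectors of total degree at most `L`, encoded by their first three entries. -/
noncomputable def matExponent (L : ℕ) (t : Fin 3 → Fin (L + 1)) : Fin 2 × Fin 2 →₀ ℕ :=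
  Finsupp.single (0, 0) (t 0 : ℕ) + Finsupp.single (0, 1) (t 1 : ℕ) +
    Finsupp.single (1, 0) (t 2 : ℕ) +
    Finsupp.single (1, 1) (L - (t 0 : ℕ) - (t 1 : ℕ) - (t 2 : ℕ))

theorem exists_matExponent_eq {L : ℕ} {m : Fin 2 × Fin 2 →₀ ℕ} (hm : m.degree = L) :
    ∃ t, matExponent L t = m := by
  have hsum : m (0, 0) + m (0, 1) + m (1, 0) + m (1, 1) = L := by
    rw [← hm, Finsupp.degree_eq_sum, Fintype.sum_prod_type]
    simp only [Fin.sum_univ_two]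
    ring
  refine ⟨![⟨m (0, 0), by omega⟩, ⟨m (0, 1), by omega⟩, ⟨m (1, 0), by omega⟩], ?_⟩
  have h : L - m (0, 0) - m (0, 1) - m (1, 0) = m (1, 1) := by omega
  ext ⟨i, j⟩
  fin_cases i <;> fin_cases j <;> simp [matExponent, h]

theorem exists_relation_of_isHomogeneous {K ι : Type} [CommRing K] [Nontrivial K] [Fintype ι]
    {L : ℕ} (hL : (L + 1) ^ 3 < Fintype.card ι) {F : ι → MvPolynomial (Fin 2 × Fin 2) K}
    (hF : ∀ i, (F i).IsHomogeneous L) : ∃ x : ι → K, x ≠ 0 ∧ ∑ i, C (x i) * F i = 0 := by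
  have hdep : ¬ LinearIndependent K
      fun (i : ι) (t : Fin 3 → Fin (L + 1)) => coeff (matExponent L t) (F i) := by
    intro h
    have := h.fintype_card_le_finrank
    simp at this
    omega
  obtain ⟨x, hx, i, hi⟩ := Fintype.not_linearIndependent_iff.1 hdep
  refine ⟨x, Function.ne_iff.2 ⟨i, hi⟩, ?_⟩
  ext m
  rw [coeff_sum, coeff_zero]
  simp only [coeff_C_mul]
  by_cases hm : m.degree = L
  · obtain ⟨t, rfl⟩ := exists_matExponent_eq hm
    have := congrFun hx t
    simpa using this
  · refine Finset.sum_eq_zero fun i _ => ?_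
    rw [(hF i).coeff_eq_zero hm, mul_zero]

theorem exists_invariant_relation (n : ℕ) (k : Fin 4 → Fin (n + 1)) :
    ∃ (D : ℕ) (s : (Fin 4 → Fin D) → MvPolynomial (Fin (n + 1)) ℂ), s ≠ 0 ∧
      (∀ e, s e ∈ invariantAlgebra n) ∧ ∑ e, s e * ∏ i, X (k i) ^ (2 * (e i : ℕ)) = 0 := by
  set D := (8 * n + 1) ^ 3 + 1 with hD
  set y : (Fin 4 → Fin D) → MvPolynomial (Fin (n + 1)) ℂ := fun e => ∏ i, X (k i) ^ (2 * (e i : ℕ))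
  have hy : ∀ e, (y e).IsHomogeneous (2 * ∑ i, (e i : ℕ)) := by
    intro e
    rw [Finset.mul_sum]
    refine IsHomogeneous.prod _ _ _ fun i _ => ?_
    simpa using (isHomogeneous_X ℂ (k i)).pow (2 * (e i : ℕ))
  have hcard : (8 * n * D + 1) ^ 3 < Fintype.card (Fin 4 → Fin D) := by
    have h1 : 8 * n * D + 1 ≤ (8 * n + 1) * D := by
      rw [add_mul, one_mul]; omega
    calc (8 * n * D + 1) ^ 3 ≤ ((8 * n + 1) * D) ^ 3 := Nat.pow_le_pow_left h1 3
      _ = (8 * n + 1) ^ 3 * D ^ 3 := mul_pow _ _ _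
      _ < D * D ^ 3 := Nat.mul_lt_mul_of_pos_right (by omega) (by positivity)
      _ = Fintype.card (Fin 4 → Fin D) := by simp [pow_succ, mul_assoc]
  have hF : ∀ e : Fin 4 → Fin D,
      (genDet _ ^ (n * (4 * D - ∑ i, (e i : ℕ))) * orbitMap n (y e)).IsHomogeneous
      (8 * n * D) := by
    intro e
    have hle : ∑ i, (e i : ℕ) ≤ 4 * D := by
      refine (Finset.sum_le_sum fun i _ => (e i).2.le).trans ?_
      simp
    convert ((genDet_isHomogeneous _).pow _).mul (orbitMap_isHomogeneous (hy e)) using 1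
    obtain ⟨r, hr⟩ := Nat.exists_eq_add_of_le hle
    rw [hr, Nat.add_sub_cancel_left]
    calc 8 * n * D = 2 * n * (4 * D) := by ring
      _ = _ := by rw [hr]; ring
  obtain ⟨x, hx, hxF⟩ := exists_relation_of_isHomogeneous hcard hF
  have hxy : ∀ g, ∑ e, x e * slSubst n g (y e) = 0 := by
    intro g
    have h := congrArg (eval fun p : Fin 2 × Fin 2 => (C (g.1 p.1 p.2) :
      MvPolynomial (Fin (n + 1)) ℂ)) hxF
    have hdet : eval (fun p : Fin 2 × Fin 2 => (C (g.1 p.1 p.2) :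
        MvPolynomial (Fin (n + 1)) ℂ)) (genDet _) = 1 := by
      refine MvPolynomial.funext fun a => ?_
      rw [eval_eval_C, evalPair_genDet, g.2, map_one]
    rw [map_sum, map_zero] at h
    rw [← h]
    refine Finset.sum_congr rfl fun e _ => ?_
    rw [map_mul, map_mul, map_pow, hdet, one_pow, one_mul, eval_C]
    rfl
  have hperfect : commutator (Matrix.SpecialLinearGroup (Fin 2) ℂ) = ⊤ :=
    Matrix.SL2.commutator_eq_top (a := 2) (by norm_num) (by norm_num)
  obtain ⟨s, hs, hsinv, hsum⟩ :=
    exists_fixed_relation hperfect (slSubst n) (slSubst_unit n) y hx hxy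
  exact ⟨D, s, hs, fun e => mem_invariantAlgebra_iff_slSubst.2 fun g => hsinv g e, hsum⟩

theorem not_algebraicIndependent_X_comp (n : ℕ) (k : Fin 4 → Fin (n + 1)) :
    ¬ AlgebraicIndependent (invariantAlgebra n)
      fun i => (X (k i) : MvPolynomial (Fin (n + 1)) ℂ) := by
  obtain ⟨D, s, hs, hsinv, hsum⟩ := exists_invariant_relation n k
  intro h
  rw [algebraicIndependent_iff] at h
  let μ : (Fin 4 → Fin D) → (Fin 4 →₀ ℕ) := fun e =>
    Finsupp.equivFunOnFinite.symm fun i => 2 * (e i : ℕ)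
  have hμ : Function.Injective μ := by
    intro e e' hee
    funext i
    have := DFunLike.congr_fun hee i
    simp only [μ, Finsupp.coe_equivFunOnFinite_symm] at this
    exact Fin.ext (by omega)
  have h0 := h (∑ e, monomial (μ e) (⟨s e, hsinv e⟩ : invariantAlgebra n)) (by
    rw [map_sum, ← hsum]
    refine Finset.sum_congr rfl fun e _ => ?_
    rw [aeval_monomial, Finsupp.prod_fintype _ _ (by simp)]
    rfl)
  refine hs (funext fun e => ?_)
  have h1 := congrArg (coeff (μ e)) h0
  rw [coeff_sum, Finset.sum_eq_single e] at h1
  · rw [coeff_monomial, if_pos rfl, coeff_zero] at h1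
    exact congrArg Subtype.val h1
  · intro e' _ hne
    rw [coeff_monomial, if_neg fun h => hne (hμ h)]
  · simp

theorem trdeg_le_of_adjoin_eq_top {R A ι : Type} [CommRing R] [CommRing A] [IsDomain A]
    [Algebra R A] [FaithfulSMul R A] {x : ι → A} (hx : Algebra.adjoin R (Set.range x) = ⊤) {m : ℕ}
    (h : ∀ k : Fin (m + 1) → ι, ¬ AlgebraicIndependent R (x ∘ k)) : Algebra.trdeg R A ≤ m := by
  have : Nontrivial R := (algebraMap R A).domain_nontrivial
  have : Algebra.IsAlgebraic (Algebra.adjoin R (Set.range x)) A := by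
    refine ⟨fun P => ?_⟩
    have hP : P ∈ Algebra.adjoin R (Set.range x) := hx ▸ Algebra.mem_top
    exact isAlgebraic_algebraMap (⟨P, hP⟩ : Algebra.adjoin R (Set.range x))
  obtain ⟨t, ht, htb⟩ := exists_isTranscendenceBasis_subset (R := R) (Set.range x)
  rw [← htb.cardinalMk_eq_trdeg]
  by_contra! hlt
  have hle : Cardinal.mk (Fin (m + 1)) ≤ Cardinal.mk t := by
    rw [Cardinal.mk_fin, Nat.cast_succ, ← Cardinal.succ_natCast]
    exact Order.succ_le_of_lt hlt
  obtain ⟨f⟩ := Cardinal.le_def _ _ |>.1 hle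
  choose k hk using fun i => ht (f i).2
  refine h k ?_
  have hcomp : x ∘ k = Subtype.val ∘ f := funext hk
  rw [hcomp]
  exact htb.1.comp f f.injective

theorem trdeg_le_three (n : ℕ) :
    Algebra.trdeg (invariantAlgebra n) (MvPolynomial (Fin (n + 1)) ℂ) ≤ (3 : ℕ) := by
  refine trdeg_le_of_adjoin_eq_top (x := X) ?_ (not_algebraicIndependent_X_comp n)
  rw [eq_top_iff]
  intro P _
  have hP : P ∈ Algebra.adjoin ℂ (Set.range (X : Fin (n + 1) → _)) := by
    rw [adjoin_range_X]; exact Algebra.mem_top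
  induction hP using Algebra.adjoin_induction with
  | mem x hx => exact Algebra.subset_adjoin hx
  | algebraMap r => exact Subalgebra.algebraMap_mem _ (algebraMap ℂ (invariantAlgebra n) r)
  | add x y _ _ hx hy => exact add_mem (hx trivial) (hy trivial)
  | mul x y _ _ hx hy => exact mul_mem (hx trivial) (hy trivial)

theorem trdeg_add_trdeg_eq {K A : Type} [Field K] [CommRing A] [IsDomain A] [Algebra K A]
    (S : Subalgebra K A) : Algebra.trdeg K S + Algebra.trdeg S A = Algebra.trdeg K A :=
  _root_.trdeg_add_eq K S

theorem le_trdeg_invariantAlgebra (n : ℕ) :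
    ((n - 2 : ℕ) : Cardinal) ≤ Algebra.trdeg ℂ (invariantAlgebra n) := by
  have h := trdeg_add_trdeg_eq (invariantAlgebra n)
  rw [MvPolynomial.trdeg_of_isDomain, Cardinal.mk_fin, Cardinal.lift_natCast] at h
  have h3 := trdeg_le_three n
  by_contra! hlt
  obtain ⟨r, hr⟩ := Cardinal.lt_aleph0.1 (hlt.trans (Cardinal.natCast_lt_aleph0))
  obtain ⟨q, hq⟩ := Cardinal.lt_aleph0.1 (h3.trans_lt (Cardinal.natCast_lt_aleph0))
  rw [hr, hq] at h
  rw [hr] at hlt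
  rw [hq] at h3
  norm_cast at h hlt h3
  omega

theorem algebraicIndependent_of_isIntegral {K A ι : Type} [Field K] [CommRing A] [IsDomain A]
    [Algebra K A] [Finite ι] {S : Subalgebra K A} {v : ι → A} (hv : ∀ j, v j ∈ S)
    (hint : ∀ x ∈ S, IsIntegral (Algebra.adjoin K (Set.range v)) x)
    (hcard : Cardinal.mk ι ≤ Algebra.trdeg K S) : AlgebraicIndependent K v := by
  let w : ι → S := fun j => ⟨v j, hv j⟩
  have hA : Algebra.adjoin K (Set.range v) ≤ S := Algebra.adjoin_le (Set.range_subset_iff.2 hv)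
  have hw : (Algebra.adjoin K (Set.range w)).map S.val = Algebra.adjoin K (Set.range v) := by
    rw [AlgHom.map_adjoin, ← Set.range_comp]
    rfl
  let φ : Algebra.adjoin K (Set.range v) →ₐ[K] Algebra.adjoin K (Set.range w) :=
    (Subalgebra.inclusion hA).codRestrict _ fun a => by
      obtain ⟨b, hb, hba⟩ := hw.ge a.2
      have : Subalgebra.inclusion hA a = b := Subtype.ext hba.symm
      rwa [this]
  have : Algebra.IsAlgebraic (Algebra.adjoin K (Set.range w)) S := by
    refine ⟨fun x => IsIntegral.isAlgebraic ?_⟩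
    obtain ⟨p, hp, hpx⟩ := hint x.1 x.2
    refine ⟨p.map φ.toRingHom, hp.map _, Subtype.val_injective ?_⟩
    rw [← Subalgebra.coe_val, ← AlgHom.coe_toRingHom, Polynomial.eval₂_map, Polynomial.hom_eval₂,
      map_zero, ← hpx]
    rfl
  have hind := Algebra.IsAlgebraic.isTranscendenceBasis_of_le_trdeg_of_finite K w hcard
  exact hind.1.map' (f := S.val) Subtype.val_injective

theorem isHSOP_of_zeroLocus_subset_nullcone {n : ℕ}
    {v : Fin (n - 2) → MvPolynomial (Fin (n + 1)) ℂ} (hinv : ∀ j, v j ∈ invariantAlgebra n)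
    (hhom : ∀ j, ∃ d : ℕ, 0 < d ∧ (v j).IsHomogeneous d)
    (h : {a : Fin (n + 1) → ℂ | ∀ j, eval a (v j) = 0} ⊆ nullcone n) : IsHSOP n v := by
  obtain ⟨F, hFS, hF⟩ := exists_finset_span_of_zeroLocus_subset_nullcone hinv hhom h
  refine ⟨hinv, fun j => (hhom j).imp fun d hd => hd.2, ?_, F, hFS, hF⟩
  refine algebraicIndependent_of_isIntegral hinv (fun x hx => isIntegral_of_subalgebra_le_span
    (Algebra.adjoin_le (Set.range_subset_iff.2 hinv)) hFS hF hx) ?_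
  rw [Cardinal.mk_fin]
  exact le_trdeg_invariantAlgebra n

theorem nullcone_subset_zeroLocus {n : ℕ} {ι : Type} {v : ι → MvPolynomial (Fin (n + 1)) ℂ}
    (hinv : ∀ j, v j ∈ invariantAlgebra n)
    (hhom : ∀ j, ∃ d : ℕ, 0 < d ∧ (v j).IsHomogeneous d) :
    nullcone n ⊆ {a : Fin (n + 1) → ℂ | ∀ j, eval a (v j) = 0} := by
  intro a ha j
  obtain ⟨d, hd0, hd⟩ := hhom j
  exact ha (v j) (hinv j) d hd0 hd

/-- (Hilbert) Let `n ≥ 3` and let `i₁, …, i_{n-2}` be homogeneous polynomial invariants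
of `Vₙ` of positive degree. Then their common vanishing locus in `Vₙ` equals the
nullcone `N(Vₙ)` if and only if they form a homogeneous system of parameters of
`O(Vₙ)^{SL₂}`. -/
theorem hilbert_nullcone_hsop (n : ℕ) (hn : 3 ≤ n)
    (v : Fin (n - 2) → MvPolynomial (Fin (n + 1)) ℂ)
    (hinv : ∀ j, v j ∈ invariantAlgebra n)
    (hhom : ∀ j, ∃ d : ℕ, 0 < d ∧ (v j).IsHomogeneous d) :
    {a : Fin (n + 1) → ℂ | ∀ j, eval a (v j) = 0} = nullcone n ↔ IsHSOP n v := by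
  constructor
  · intro h
    exact isHSOP_of_zeroLocus_subset_nullcone hinv hhom h.subset
  · intro h
    exact (zeroLocus_subset_nullcone_of_isHSOP hhom h).antisymm
      (nullcone_subset_zeroLocus hinv hhom)
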